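/- Let F be a finite field. Neither the projective special linear group PSL(3,F) nor the projective general linear group PGL(3,F) admits a string C-group representation of any rank. -/

import Mathlib

/-- A string C-group representation of rank `n` of a group `G`: a family of `n`
involutions generating `G`, satisfying the commuting (string) property and the
intersection property. -/
def IsStringCGroupRep {G : Type*} [Group G] {n : ℕ} (ρ : Fin n → G) : Prop :=
  (∀ i, orderOf (ρ i) = 2) ∧
  Subgroup.closure (Set.range ρ) = ⊤ ∧
  (∀ i j : Fin n, i.val + 1 < j.val → Commute (ρ i) (ρ j)) ∧
  (∀ I J : Set (Fin n),
    Subgroup.closure (ρ '' I) ⊓ Subgroup.closure (ρ '' J) = Subgroup.closure (ρ '' (I ∩ J)))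

/-- The projective general linear group: the quotient of `GL(n, R)` by its center. -/
abbrev ProjectiveGeneralLinearGroup (n : Type*) [DecidableEq n] [Fintype n]
    (R : Type*) [CommRing R] : Type _ :=
  Matrix.GeneralLinearGroup n R ⧸ Subgroup.center (Matrix.GeneralLinearGroup n R)

open Matrix in
/-- A tridiagonal matrix with nonzero off-diagonal entries is symmetrizable. -/
theorem exists_symmetrizer_of_tridiagonal {F : Type*} [Field F] {n : ℕ}
    (M : Matrix (Fin n) (Fin n) F)
    (hfar : ∀ i j : Fin n, i.val + 1 < j.val → M i j = 0 ∧ M j i = 0)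
    (hadj : ∀ i j : Fin n, i.val + 1 = j.val → M i j ≠ 0 ∧ M j i ≠ 0) :
    ∃ d : Fin n → F, (∀ i, d i ≠ 0) ∧ ∀ i j, d i * M i j = d j * M j i := by
  let a : ℕ → F := fun l =>
    if h : l + 1 < n then M ⟨l, by omega⟩ ⟨l + 1, h⟩ / M ⟨l + 1, h⟩ ⟨l, by omega⟩ else 1
  have ha : ∀ l, a l ≠ 0 := by
    intro l
    by_cases h : l + 1 < n
    · have := hadj ⟨l, by omega⟩ ⟨l + 1, h⟩ rfl
      simp only [a, h, dif_pos]
      exact div_ne_zero this.1 this.2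
    · simp [a, h]
  have key : ∀ i j : Fin n, i.val < j.val →
      (∏ l ∈ Finset.range i.val, a l) * M i j = (∏ l ∈ Finset.range j.val, a l) * M j i := by
    intro i j hij
    rcases Nat.lt_or_ge (i.val + 1) j.val with h | h
    · simp [(hfar i j h).1, (hfar i j h).2]
    · have hj : i.val + 1 = j.val := by omega
      have hn : i.val + 1 < n := hj ▸ j.isLt
      have hj' : (⟨i.val + 1, hn⟩ : Fin n) = j := Fin.ext hj
      have hai : a i.val = M i j / M j i := by
        simp only [a, hn, dif_pos, hj']
      rw [← hj, Finset.prod_range_succ, hai]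
      have := (hadj i j hj).2
      field_simp
  refine ⟨fun i => ∏ l ∈ Finset.range i.val, a l,
    fun i => Finset.prod_ne_zero_iff.mpr fun l _ => ha l, fun i j => ?_⟩
  rcases lt_trichotomy i.val j.val with h | h | h
  · exact key i j h
  · rw [Fin.ext h]
  · exact (key j i h).symm

open Matrix in
/-- A tridiagonal system of transvections or reflections `x ↦ x + (φ i ⬝ᵥ x) • v i` acting
irreducibly preserves a nonzero bilinear form. -/
theorem exists_invariant_form_of_tridiagonal {F m : Type*} [Field F] [Fintype m]
    [DecidableEq m] {n : ℕ} (hn : 0 < n) (v φ : Fin n → m → F)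
    (hv : ∀ i, v i ≠ 0) (hφ : ∀ i, φ i ≠ 0) (hdiag : ∀ i, φ i ⬝ᵥ v i = -2)
    (hfar : ∀ i j : Fin n, i.val + 1 < j.val → φ i ⬝ᵥ v j = 0 ∧ φ j ⬝ᵥ v i = 0)
    (hirr : ∀ W : Submodule F (m → F),
      (∀ i, ∀ x ∈ W, x + (φ i ⬝ᵥ x) • v i ∈ W) → W = ⊥ ∨ W = ⊤) :
    ∃ B : Matrix m m F, B ≠ 0 ∧ ∀ i x y,
      (x + (φ i ⬝ᵥ x) • v i) ⬝ᵥ B *ᵥ (y + (φ i ⬝ᵥ y) • v i) = x ⬝ᵥ B *ᵥ y := by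
  have hspan : ∀ S : Set (Fin n), S.Nonempty → (∀ k ∉ S, ∀ j ∈ S, φ k ⬝ᵥ v j = 0) →
      Submodule.span F (v '' S) = ⊤ := by
    rintro S ⟨s, hs⟩ hS
    refine (hirr _ fun k x hx => ?_).resolve_left fun h => ?_
    · by_cases hk : k ∈ S
      · exact add_mem hx (Submodule.smul_mem _ _ (Submodule.subset_span ⟨k, hk, rfl⟩))
      · have : φ k ⬝ᵥ x = 0 := by
          induction hx using Submodule.span_induction with
          | mem x hx => obtain ⟨j, hj, rfl⟩ := hx; exact hS k hk j hj
          | zero => simp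
          | add x y _ _ hx hy => rw [dotProduct_add, hx, hy, add_zero]
          | smul c x _ hx => rw [dotProduct_smul, hx, smul_zero]
        simpa [this] using hx
    · refine hv s ((Submodule.mem_bot F).mp (h ▸ ?_))
      exact Submodule.subset_span ⟨s, hs, rfl⟩
  have hS : ∀ S : Set (Fin n), S.Nonempty → ∀ k ∉ S,
      ¬ ∀ k ∉ S, ∀ j ∈ S, φ k ⬝ᵥ v j = 0 := by
    intro S hne k hk h
    refine hφ k (dotProduct_eq_zero _ fun x => ?_)
    have hx : x ∈ Submodule.span F (v '' S) := hspan S hne h ▸ Submodule.mem_top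
    induction hx using Submodule.span_induction with
    | mem x hx => obtain ⟨j, hj, rfl⟩ := hx; exact h k hk j hj
    | zero => simp
    | add x y _ _ hx hy => rw [dotProduct_add, hx, hy, add_zero]
    | smul c x _ hx => rw [dotProduct_smul, hx, smul_zero]
  have hadj : ∀ i j : Fin n, i.val + 1 = j.val → φ i ⬝ᵥ v j ≠ 0 ∧ φ j ⬝ᵥ v i ≠ 0 := by
    intro i j hij
    constructor
    · intro h0
      refine hS {k | i < k} ⟨j, Fin.lt_def.mpr (by omega)⟩ i (by simp) fun k hk l hl => ?_
      simp only [Set.mem_ofPred_eq, Fin.lt_def, not_lt] at hk hl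
      by_cases hkl : k.val + 1 < l.val
      · exact (hfar k l hkl).1
      · obtain rfl : k = i := Fin.ext (by omega)
        obtain rfl : l = j := Fin.ext (by omega)
        exact h0
    · intro h0
      refine hS {k | k ≤ i} ⟨i, le_refl i⟩ j
        (by simp only [Set.mem_ofPred_eq, Fin.le_def]; omega) fun k hk l hl => ?_
      simp only [Set.mem_ofPred_eq, Fin.le_def, not_le] at hk hl
      by_cases hkl : l.val + 1 < k.val
      · exact (hfar l k hkl).2
      · obtain rfl : l = i := Fin.ext (by omega)
        obtain rfl : k = j := Fin.ext (by omega)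
        exact h0
  let V : Matrix m (Fin n) F := (of v)ᵀ
  let Φ : Matrix (Fin n) m F := of φ
  have hM : ∀ i j, (Φ * V) i j = φ i ⬝ᵥ v j := fun i j => rfl
  obtain ⟨d, hd, hsymm⟩ := exists_symmetrizer_of_tridiagonal (Φ * V) hfar hadj
  obtain ⟨R, hR⟩ : ∃ R : Matrix (Fin n) m F, V * R = 1 := by
    rw [← mulVec_surjective_iff_exists_right_inverse]
    intro x
    have hx : x ∈ Submodule.span F (v '' Set.univ) :=
      hspan Set.univ ⟨⟨0, hn⟩, trivial⟩ (by simp) ▸ Submodule.mem_top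
    rw [Set.image_univ, Submodule.mem_span_range_iff_exists_fun] at hx
    obtain ⟨c, rfl⟩ := hx
    refine ⟨c, ?_⟩
    ext i
    simp [V, mulVec, dotProduct, mul_comm]
  have hDM : (Φ * V)ᵀ * diagonal d = diagonal d * (Φ * V) := by
    ext i j
    rw [mul_diagonal, diagonal_mul, transpose_apply, hsymm, mul_comm]
  have hVB : Vᵀ * (Φᵀ * diagonal d * R) = diagonal d * Φ := by
    calc _ = (Φ * V)ᵀ * diagonal d * R := by simp only [transpose_mul, Matrix.mul_assoc]
      _ = diagonal d * Φ * (V * R) := by rw [hDM]; simp only [Matrix.mul_assoc]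
      _ = _ := by rw [hR, Matrix.mul_one]
  have hBV : Φᵀ * diagonal d * R * V = Φᵀ * diagonal d := by
    have hR' : Rᵀ * Vᵀ = 1 := by rw [← transpose_mul, hR, transpose_one]
    calc _ = Rᵀ * Vᵀ * (Φᵀ * diagonal d * R * V) := by rw [hR', Matrix.one_mul]
      _ = Rᵀ * (Vᵀ * (Φᵀ * diagonal d * R) * V) := by simp only [Matrix.mul_assoc]
      _ = Rᵀ * ((Φ * V)ᵀ * diagonal d) := by rw [hVB, hDM, Matrix.mul_assoc]
      _ = Rᵀ * Vᵀ * (Φᵀ * diagonal d) := by simp only [transpose_mul, Matrix.mul_assoc]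
      _ = _ := by rw [hR', Matrix.one_mul]
  generalize hB : Φᵀ * diagonal d * R = B at hVB hBV
  have h1 : ∀ i y, v i ⬝ᵥ B *ᵥ y = d i * (φ i ⬝ᵥ y) := by
    intro i y
    have := congrFun (congrArg (· *ᵥ y) hVB) i
    simp only [← mulVec_mulVec, mulVec_diagonal] at this
    exact this
  have h2 : ∀ i x, x ⬝ᵥ B *ᵥ v i = d i * (φ i ⬝ᵥ x) := by
    intro i x
    have := congrFun (congrArg (x ᵥ* ·) hBV) i
    simp only [← vecMul_vecMul, vecMul_diagonal] at this
    rw [dotProduct_mulVec, mul_comm, dotProduct_comm (φ i)]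
    exact this
  refine ⟨B, ?_, fun i x y => ?_⟩
  · rintro rfl
    refine hφ ⟨0, hn⟩ (dotProduct_eq_zero _ fun y => ?_)
    have := h1 ⟨0, hn⟩ y
    rw [zero_mulVec, dotProduct_zero] at this
    exact (mul_eq_zero.mp this.symm).resolve_left (hd _)
  · simp only [add_dotProduct, smul_dotProduct, mulVec_add, mulVec_smul, dotProduct_add,
      dotProduct_smul, h1, h2, smul_eq_mul, hdiag]
    ring

open Matrix in
theorem exists_eq_vecMulVec_of_finrank_range_le_one {F m n : Type*} [Field F] [Fintype m]
    [Fintype n] [DecidableEq n] (A : Matrix m n F)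
    (hA : Module.finrank F (LinearMap.range A.mulVecLin) ≤ 1) :
    ∃ v φ, A = vecMulVec v φ := by
  obtain ⟨v, hv⟩ := finrank_le_one_iff.mp hA
  choose φ hφ using fun j => hv ⟨A *ᵥ Pi.single j 1, ⟨_, rfl⟩⟩
  refine ⟨v, φ, ?_⟩
  ext i j
  have := congrFun (congrArg Subtype.val (hφ j)) i
  simp only [mulVec_single_one, Submodule.coe_smul, Pi.smul_apply, smul_eq_mul] at this
  rw [vecMulVec_apply, mul_comm, this, col_apply]

open Matrix in
/-- A nonscalar `3 × 3` matrix whose square is scalar is proportional to a transvection or a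
reflection. -/
theorem exists_eq_smul_one_add_vecMulVec {F : Type*} [Field F] (A : Matrix (Fin 3) (Fin 3) F)
    (l : F) (hA : A * A = l • 1) (hdet : A.det ≠ 0) (hns : ∀ c : F, A ≠ c • 1) :
    ∃ (c : F) (v φ : Fin 3 → F), c ≠ 0 ∧ A = c • (1 + vecMulVec v φ) ∧
      v ≠ 0 ∧ φ ≠ 0 ∧ φ ⬝ᵥ v = -2 := by
  have hl : A.det * A.det = l ^ 3 := by
    rw [← det_mul, hA, det_smul, det_one]; simp
  have hl0 : l ≠ 0 := by rintro rfl; simp_all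
  suffices h : ∃ (c : F) (v φ : Fin 3 → F), c * c = l ∧ A = c • (1 + vecMulVec v φ) by
    obtain ⟨c, v, φ, hc, rfl⟩ := h
    have hc0 : c ≠ 0 := by rintro rfl; simp_all
    have hv : v ≠ 0 := by rintro rfl; exact hns c (by simp)
    have hφ : φ ≠ 0 := by rintro rfl; exact hns c (by simp)
    refine ⟨c, v, φ, hc0, rfl, hv, hφ, ?_⟩
    rw [smul_mul_smul_comm, hc] at hA
    have h1 := smul_right_injective _ hl0 hA
    have h2 : (2 + φ ⬝ᵥ v) • vecMulVec v φ = 0 := by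
      simp only [mul_add, add_mul, Matrix.mul_one, Matrix.one_mul, vecMulVec_mul_vecMulVec,
        vecMulVec_smul] at h1
      rw [add_smul, two_smul]
      rw [add_assoc] at h1
      rw [← add_eq_left.mp h1]
      abel
    rcases smul_eq_zero.mp h2 with h | h
    · linear_combination h
    · exact absurd h (vecMulVec_ne_zero hv hφ)
  set c := A.det / l with hcdef
  have hc : c * c = l := by rw [hcdef]; field_simp; linear_combination hl
  have hc0 : c ≠ 0 := div_ne_zero hdet hl0
  have hprod : (A - c • 1) * (A + c • 1) = 0 := by
    simp [sub_mul, mul_add, hA, smul_sub, smul_smul, hc]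
  have hker : LinearMap.range (A + c • 1).mulVecLin ≤ LinearMap.ker (A - c • 1).mulVecLin := by
    rintro _ ⟨x, rfl⟩
    simp only [LinearMap.mem_ker, mulVecLin_apply, mulVec_mulVec, hprod, zero_mulVec]
  have h3 := LinearMap.finrank_range_add_finrank_ker (A - c • 1).mulVecLin
  have h4 := Submodule.finrank_mono hker
  rw [Module.finrank_fin_fun] at h3
  rcases Nat.lt_or_ge 1 (Module.finrank F (LinearMap.range (A - c • 1).mulVecLin)) with h | h
  · obtain ⟨v, φ, hvφ⟩ := exists_eq_vecMulVec_of_finrank_range_le_one (A + c • 1) (by omega)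
    refine ⟨-c, (-c⁻¹) • v, φ, by rw [neg_mul_neg, hc], ?_⟩
    rw [smul_vecMulVec, ← hvφ, smul_add, smul_smul, neg_mul_neg, mul_inv_cancel₀ hc0, one_smul]
    simp
  · obtain ⟨v, φ, hvφ⟩ := exists_eq_vecMulVec_of_finrank_range_le_one (A - c • 1) h
    refine ⟨c, c⁻¹ • v, φ, hc, ?_⟩
    rw [smul_vecMulVec, ← hvφ, smul_add, smul_smul, mul_inv_cancel₀ hc0, one_smul]
    simp

open Matrix in
theorem dotProduct_eq_zero_or_eq_of_commute {F m : Type*} [Field F] [Fintype m] [DecidableEq m]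
    {v φ w ψ : m → F} (hv : v ≠ 0) (hφ : φ ≠ 0) (hw : w ≠ 0) (hψ : ψ ≠ 0)
    (h1 : φ ⬝ᵥ v = -2) (h2 : ψ ⬝ᵥ w = -2)
    (h : Commute (1 + vecMulVec v φ) (1 + vecMulVec w ψ)) :
    (φ ⬝ᵥ w = 0 ∧ ψ ⬝ᵥ v = 0) ∨ vecMulVec v φ = vecMulVec w ψ := by
  have hPQ : (φ ⬝ᵥ w) • vecMulVec v ψ = (ψ ⬝ᵥ v) • vecMulVec w φ := by
    have h := h.eq
    simp only [mul_add, add_mul, Matrix.mul_one, Matrix.one_mul, vecMulVec_mul_vecMulVec,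
      vecMulVec_smul] at h
    have : ∀ a b c d e : Matrix m m F, a + b + (c + d) = a + c + (b + e) → d = e := by
      intro a b c d e h
      rw [add_add_add_comm] at h
      simpa [add_assoc] using h
    exact this _ _ _ _ _ h
  by_cases hb : ψ ⬝ᵥ v = 0
  · rw [hb, zero_smul] at hPQ
    exact Or.inl ⟨(smul_eq_zero.mp hPQ).resolve_right (vecMulVec_ne_zero hv hψ), hb⟩
  have ha : φ ⬝ᵥ w ≠ 0 := by
    intro ha
    rw [ha, zero_smul] at hPQ
    exact hb ((smul_eq_zero.mp hPQ.symm).resolve_right (vecMulVec_ne_zero hw hφ))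
  have hwv : (ψ ⬝ᵥ v) • w = (-2 : F) • v := by
    have := congrArg (· *ᵥ w) hPQ
    simp only [smul_mulVec, vecMulVec_mulVec, h2, op_smul_eq_smul] at this
    rw [smul_comm (ψ ⬝ᵥ v)] at this
    exact (smul_right_injective _ ha this).symm
  have hφψ : (ψ ⬝ᵥ v) • φ = (-2 : F) • ψ := by
    have := congrArg (φ ᵥ* ·) hPQ
    simp only [vecMul_smul, vecMul_vecMulVec, h1] at this
    rw [smul_comm (ψ ⬝ᵥ v)] at this
    exact (smul_right_injective _ ha this).symm
  refine Or.inr (smul_right_injective _ hb ?_)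
  simp only
  rw [← vecMulVec_smul, hφψ, ← smul_vecMulVec, hwv, vecMulVec_smul, smul_vecMulVec]

open Matrix in
theorem transvection_mulVec {R m : Type*} [CommRing R] [Fintype m] [DecidableEq m] (i j : m)
    (c : R) (x : m → R) : transvection i j c *ᵥ x = x + Pi.single i (c * x j) := by
  rw [transvection, add_mulVec, one_mulVec, single_mulVec]
  rfl

open Matrix in
/-- The elementary transvections act irreducibly. -/
theorem eq_bot_or_eq_top_of_transvection {F m : Type*} [Field F] [Fintype m] [DecidableEq m]
    [Nontrivial m] (W : Submodule F (m → F))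
    (hW : ∀ i j, i ≠ j → ∀ x ∈ W, transvection i j (1 : F) *ᵥ x ∈ W) : W = ⊥ ∨ W = ⊤ := by
  refine or_iff_not_imp_left.mpr fun hne => ?_
  obtain ⟨x, hx, hx0⟩ := W.ne_bot_iff.mp hne
  obtain ⟨j, hj⟩ := Function.ne_iff.mp hx0
  have step : ∀ i j, i ≠ j → ∀ x ∈ W, x j ≠ 0 → Pi.single i (1 : F) ∈ W := by
    intro i j hij x hx hxj
    have h := W.sub_mem (hW i j hij x hx) hx
    rw [transvection_mulVec, one_mul, add_sub_cancel_left] at h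
    have h' := W.smul_mem (x j)⁻¹ h
    rwa [← Pi.single_smul', smul_eq_mul, inv_mul_cancel₀ hxj] at h'
  have hmem : ∀ i, Pi.single i (1 : F) ∈ W := by
    intro i
    by_cases hij : i = j
    · subst hij
      obtain ⟨k, hk⟩ := exists_ne i
      exact step i k hk.symm _ (step k i hk x hx hj) (by simp)
    · exact step i j hij x hx hj
  refine eq_top_iff.mpr fun y _ => ?_
  rw [pi_eq_sum_univ' y]
  refine W.sum_mem fun i _ => W.smul_mem _ ?_
  exact hmem i

open Matrix in
/-- No nonzero bilinear form on a space of dimension at least three is preserved up to scalars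
by all elementary transvections. -/
theorem eq_zero_of_transvection_form {F m : Type*} [Field F] [Fintype m] [DecidableEq m]
    (hm : 2 < Fintype.card m) (B : Matrix m m F)
    (hB : ∀ i j, i ≠ j → ∃ l : F, ∀ x y,
      (transvection i j (1 : F) *ᵥ x) ⬝ᵥ B *ᵥ (transvection i j (1 : F) *ᵥ y) =
        l * (x ⬝ᵥ B *ᵥ y)) : B = 0 := by
  ext a b
  by_contra hab
  obtain ⟨j, hj⟩ : ∃ j, j ∉ ({a, b} : Finset m) := by
    by_contra! h
    have h1 := Finset.card_le_card (fun x _ => h x : Finset.univ ⊆ ({a, b} : Finset m))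
    have h2 := Finset.card_le_two (a := a) (b := b)
    rw [Finset.card_univ] at h1
    omega
  simp only [Finset.mem_insert, Finset.mem_singleton, not_or] at hj
  obtain ⟨l, hl⟩ := hB a j (Ne.symm hj.1)
  have h1 := hl (Pi.single a 1) (Pi.single b 1)
  have h2 := hl (Pi.single j 1) (Pi.single b 1)
  simp only [transvection_mulVec, Pi.single_eq_of_ne hj.1, Pi.single_eq_of_ne hj.2,
    Pi.single_eq_same, mul_zero, mul_one, Pi.single_zero, add_zero, add_dotProduct,
    single_one_dotProduct] at h1 h2
  simp only [mulVec_single_one, col_apply] at h1 h2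
  have hl1 : l = 1 := mul_right_cancel₀ hab (by rw [one_mul, ← h1])
  rw [hl1, one_mul] at h2
  exact hab (add_eq_left.mp h2)

open Matrix in
/-- Two `3 × 3` matrices squaring to one that commute up to a scalar commute. -/
theorem commute_of_mul_eq_smul_mul {F : Type*} [Field F] {A B : Matrix (Fin 3) (Fin 3) F}
    (hA : A * A = 1) (hB : B * B = 1) {z : F} (h : A * B = z • (B * A)) : Commute A B := by
  have hd : (A * B).det * (A * B).det = 1 := by
    have h1 : A.det * A.det = 1 := by rw [← det_mul, hA, det_one]
    have h2 : B.det * B.det = 1 := by rw [← det_mul, hB, det_one]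
    rw [det_mul]; linear_combination h1 * B.det * B.det + h2
  have hz3 : z ^ 3 = 1 := by
    have h1 : (A * B).det = z ^ 3 * (A * B).det := by
      conv_lhs => rw [h, det_smul, det_mul, mul_comm B.det, ← det_mul]
      simp
    linear_combination hd - z ^ 3 * hd - (A * B).det * h1
  have hz2 : z ^ 2 = 1 := by
    have h1 : B = (z ^ 2) • B := by
      calc B = A * (A * B) := by rw [← Matrix.mul_assoc, hA, Matrix.one_mul]
        _ = z • ((A * B) * A) := by
          conv_lhs => rw [h, mul_smul_comm, ← Matrix.mul_assoc]
        _ = (z ^ 2) • (B * (A * A)) := by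
          rw [h, smul_mul_assoc, smul_smul, Matrix.mul_assoc, sq]
        _ = _ := by rw [hA, Matrix.mul_one]
    have hB0 : B ≠ 0 := by rintro rfl; simp at hB
    have h2 : (1 - z ^ 2) • B = 0 := by rw [sub_smul, one_smul, ← h1, sub_self]
    linear_combination -(smul_eq_zero.mp h2).resolve_right hB0
  have hz : z = 1 := by linear_combination hz3 - z * hz2
  rwa [hz, one_smul] at h

open Matrix in
theorem one_add_vecMulVec_mul_self {F m : Type*} [Field F] [Fintype m] [DecidableEq m]
    {v φ : m → F} (h : φ ⬝ᵥ v = -2) :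
    (1 + vecMulVec v φ) * (1 + vecMulVec v φ) = 1 := by
  simp only [mul_add, add_mul, Matrix.mul_one, Matrix.one_mul, vecMulVec_mul_vecMulVec,
    vecMulVec_smul, h]
  module

open Matrix in
/-- If a group `H` maps to `GL(3, F)` with image containing `SL(3, F)`, so that the center of `H`
is the preimage of the scalars, then `H` modulo its center has no string C-group
representation. -/
theorem not_isStringCGroupRep_quotient_center {F H : Type*} [Field F] [Group H]
    (f : H →* GL (Fin 3) F)
    (hf : ∀ g, f g ∈ Subgroup.center (GL (Fin 3) F) ↔ g ∈ Subgroup.center H)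
    (hSL : ∀ s : SpecialLinearGroup (Fin 3) F, ∃ g, f g = s.toGL)
    {n : ℕ} (ρ : Fin n → H ⧸ Subgroup.center H) : ¬ IsStringCGroupRep ρ := by
  rintro ⟨hord, hgen, hcomm, hint⟩
  choose a ha using fun i => QuotientGroup.mk_surjective (ρ i)
  have hK : ∀ K : Subgroup (GL (Fin 3) F), Subgroup.center _ ≤ K → (∀ i, f (a i) ∈ K) →
      ∀ s : SpecialLinearGroup (Fin 3) F, s.toGL ∈ K := by
    intro K hcK haK s
    obtain ⟨g, hg⟩ := hSL s
    have hle : Subgroup.closure (Set.range ρ) ≤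
        (K.comap f).map (QuotientGroup.mk' (Subgroup.center H)) := by
      rw [Subgroup.closure_le]
      rintro _ ⟨i, rfl⟩
      exact ⟨a i, haK i, ha i⟩
    rw [hgen] at hle
    obtain ⟨k, hk, hkg⟩ := hle (Subgroup.mem_top (QuotientGroup.mk g))
    have h1 := mul_mem (show f k ∈ K from hk) (hcK ((hf _).mpr (QuotientGroup.eq.mp hkg)))
    rwa [← map_mul, mul_inv_cancel_left, hg] at h1
  have hscalar : ∀ g : GL (Fin 3) F, g ∈ Subgroup.center _ ↔
      ∃ c : F, (g : Matrix (Fin 3) (Fin 3) F) = c • 1 := by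
    intro g
    rw [GeneralLinearGroup.mem_center_iff_val_mem_range_scalar]
    simp only [Set.mem_range, scalar_apply, smul_one_eq_diagonal, eq_comm]
  have hinj : ∀ i j, i ≠ j → ρ i ≠ ρ j := by
    intro i j hij h
    have h1 := hint {i} {j}
    rw [Set.image_singleton, Set.image_singleton, h, inf_idem,
      Set.singleton_inter_eq_empty.mpr (by simpa using hij), Set.image_empty,
      Subgroup.closure_empty] at h1
    have h2 : ρ j = 1 := Subgroup.mem_bot.mp (h1 ▸ Subgroup.subset_closure rfl)
    have := hord j
    rw [h2, orderOf_one] at this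
    omega
  have hform : ∀ i, ∃ (c : F) (v φ : Fin 3 → F), c ≠ 0 ∧
      (f (a i) : Matrix (Fin 3) (Fin 3) F) = c • (1 + vecMulVec v φ) ∧
      v ≠ 0 ∧ φ ≠ 0 ∧ φ ⬝ᵥ v = -2 := by
    intro i
    have h2 : a i * a i ∈ Subgroup.center H := by
      rw [← QuotientGroup.eq_one_iff, QuotientGroup.mk_mul, ha, ← pow_two, ← hord i,
        pow_orderOf_eq_one]
    obtain ⟨l, hl⟩ := (hscalar _).mp ((hf _).mpr h2)
    rw [map_mul, Units.val_mul] at hl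
    refine exists_eq_smul_one_add_vecMulVec _ l hl
      (GeneralLinearGroup.det_ne_zero _) fun c hc => ?_
    have h3 := (hf _).mp ((hscalar _).mpr ⟨c, hc⟩)
    rw [← QuotientGroup.eq_one_iff, ha] at h3
    have := hord i
    rw [h3, orderOf_one] at this
    omega
  choose c v φ hc hA hv hφ hdiag using hform
  let T (i j : Fin 3) (hij : i ≠ j) : SpecialLinearGroup (Fin 3) F :=
    ⟨transvection i j 1, det_transvection_of_ne i j hij 1⟩
  have hn : 0 < n := by
    rw [pos_iff_ne_zero]
    rintro rfl
    obtain ⟨c, hc⟩ := (hscalar _).mp (hK _ le_rfl finZeroElim (T 0 1 (by decide)))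
    rw [SpecialLinearGroup.coe_GL_coe_matrix] at hc
    simpa [T, transvection] using congrFun₂ hc 0 1
  have hfar : ∀ i j : Fin n, i.val + 1 < j.val → φ i ⬝ᵥ v j = 0 ∧ φ j ⬝ᵥ v i = 0 := by
    intro i j hij
    have h1 : (a j * a i)⁻¹ * (a i * a j) ∈ Subgroup.center H := by
      rw [← QuotientGroup.eq, QuotientGroup.mk_mul, QuotientGroup.mk_mul, ha, ha]
      exact (hcomm i j hij).symm
    obtain ⟨z, hz⟩ := (hscalar _).mp ((hf _).mpr h1)
    have h2 : f (a i) * f (a j) = f (a j) * f (a i) * f ((a j * a i)⁻¹ * (a i * a j)) := by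
      simp only [← map_mul]; congr 1; group
    have h3 := congrArg Units.val h2
    simp only [Units.val_mul] at h3
    rw [hz, hA, hA, smul_mul_smul_comm, smul_mul_smul_comm, mul_smul_comm, Matrix.mul_one,
      mul_comm (c j), smul_comm z] at h3
    have h4 := commute_of_mul_eq_smul_mul (one_add_vecMulVec_mul_self (hdiag i))
      (one_add_vecMulVec_mul_self (hdiag j))
      (smul_right_injective _ (mul_ne_zero (hc i) (hc j)) h3)
    refine (dotProduct_eq_zero_or_eq_of_commute (hv i) (hφ i) (hv j) (hφ j) (hdiag i) (hdiag j)
      h4).resolve_right fun h5 => ?_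
    refine hinj i j (by rintro rfl; omega) ?_
    rw [← ha, ← ha, QuotientGroup.eq, ← hf, hscalar]
    refine ⟨(c i)⁻¹ * c j, ?_⟩
    have h6 : (f (a j) : Matrix (Fin 3) (Fin 3) F) = ((c i)⁻¹ * c j) • f (a i) := by
      rw [hA, hA, h5, smul_smul, mul_right_comm, inv_mul_cancel₀ (hc i), one_mul]
    rw [map_mul, map_inv, Units.val_mul, h6, mul_smul_comm, Units.inv_mul]
  have hmulVec : ∀ i x, (f (a i) : Matrix (Fin 3) (Fin 3) F) *ᵥ x =
      c i • (x + (φ i ⬝ᵥ x) • v i) := by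
    intro i x
    rw [hA, smul_mulVec, add_mulVec, one_mulVec, vecMulVec_mulVec, op_smul_eq_smul]
  obtain ⟨B, hB0, hB⟩ := exists_invariant_form_of_tridiagonal hn v φ hv hφ hdiag hfar (by
    intro W hW
    let K : Subgroup (GL (Fin 3) F) :=
      { carrier := {g | ∀ x, (g : Matrix (Fin 3) (Fin 3) F) *ᵥ x ∈ W ↔ x ∈ W}
        one_mem' := fun x => by simp
        mul_mem' := fun {g h} hg hh x => by
          rw [Units.val_mul, ← mulVec_mulVec, hg, hh]
        inv_mem' := fun {g} hg x => by
          rw [← hg, mulVec_mulVec, Units.mul_inv, one_mulVec] }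
    refine eq_bot_or_eq_top_of_transvection W fun i j hij x hx => ?_
    refine (hK K (fun g hg x => ?_) (fun i x => ?_) (T i j hij) x).mpr hx
    · obtain ⟨c, hc⟩ := (hscalar g).mp hg
      have hc0 : c ≠ 0 := by
        rintro rfl
        exact g.ne_zero (by rw [hc, zero_smul])
      rw [hc, smul_mulVec, one_mulVec, W.smul_mem_iff hc0]
    · rw [hmulVec, W.smul_mem_iff (hc i)]
      refine ⟨fun h => ?_, hW i x⟩
      have h1 := hW i _ h
      rw [dotProduct_add, dotProduct_smul, hdiag, smul_eq_mul, add_assoc, ← add_smul] at h1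
      convert h1 using 1
      ring_nf
      simp)
  let K : Subgroup (GL (Fin 3) F) :=
    { carrier := {g | ∃ l : F, l ≠ 0 ∧ ∀ x y, ((g : Matrix (Fin 3) (Fin 3) F) *ᵥ x) ⬝ᵥ
        B *ᵥ ((g : Matrix (Fin 3) (Fin 3) F) *ᵥ y) = l * (x ⬝ᵥ B *ᵥ y)}
      one_mem' := ⟨1, one_ne_zero, fun x y => by simp⟩
      mul_mem' := by
        rintro g h ⟨l, hl, hg⟩ ⟨k, hk, hh⟩
        refine ⟨l * k, mul_ne_zero hl hk, fun x y => ?_⟩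
        rw [Units.val_mul, ← mulVec_mulVec, ← mulVec_mulVec, hg, hh, mul_assoc]
      inv_mem' := by
        rintro g ⟨l, hl, hg⟩
        refine ⟨l⁻¹, inv_ne_zero hl, fun x y => ?_⟩
        rw [eq_inv_mul_iff_mul_eq₀ hl, ← hg]
        simp only [mulVec_mulVec x, mulVec_mulVec y, Units.mul_inv, one_mulVec] }
  have hcK : Subgroup.center _ ≤ K := by
    intro g hg
    obtain ⟨c, hc⟩ := (hscalar g).mp hg
    have hc0 : c ≠ 0 := by
      rintro rfl
      exact g.ne_zero (by rw [hc, zero_smul])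
    refine ⟨c * c, mul_ne_zero hc0 hc0, fun x y => ?_⟩
    simp only [hc, smul_mulVec, one_mulVec, mulVec_smul, smul_dotProduct, dotProduct_smul,
      smul_eq_mul, mul_assoc]
  have haK : ∀ i, f (a i) ∈ K := by
    refine fun i => ⟨c i * c i, mul_ne_zero (hc i) (hc i), fun x y => ?_⟩
    simp only [hmulVec, mulVec_smul, smul_dotProduct, dotProduct_smul, smul_eq_mul, hB, mul_assoc]
  refine hB0 (eq_zero_of_transvection_form (by simp) B fun i j hij => ?_)
  obtain ⟨l, -, hl⟩ := hK K hcK haK (T i j hij)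
  exact ⟨l, hl⟩

/-- Neither `PSL(3, F)` nor `PGL(3, F)` admits a string C-group representation of
any rank, for `F` a finite field. -/
theorem psl3_pgl3_no_stringCGroupRep (F : Type*) [Field F] [Fintype F] :
    (∀ (n : ℕ) (ρ : Fin n → Matrix.ProjectiveSpecialLinearGroup (Fin 3) F),
      ¬ IsStringCGroupRep ρ) ∧
    (∀ (n : ℕ) (ρ : Fin n → ProjectiveGeneralLinearGroup (Fin 3) F),
      ¬ IsStringCGroupRep ρ) :=
  ⟨fun _ => not_isStringCGroupRep_quotient_center Matrix.SpecialLinearGroup.toGL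
      Matrix.SpecialLinearGroup.toGL_mem_center_iff fun s => ⟨s, rfl⟩,
    fun _ => not_isStringCGroupRep_quotient_center (MonoidHom.id _) (fun _ => Iff.rfl)
      fun s => ⟨s.toGL, rfl⟩⟩
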